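/- If u ∈ L(Ω) is a word whose last letter is different from d, then σ(C_u) = C_{σ(u)}, where σ(C_u) denotes the image of the set C_u under the extension of σ to infinite words. -/

import Mathlib

/-- The substitution σ on the alphabet A = {1, …, d}:
σ(1) = 12, σ(k) = k+1 for 2 ≤ k ≤ d−1, σ(d) = 1. Letters are literal natural numbers. -/
def sig (d : ℕ) (a : ℕ) : List ℕ :=
  if a = 1 then [1, 2] else if a = d then [1] else [a + 1]

/-- Extension of a substitution to finite words by concatenation. -/
def applySub (f : ℕ → List ℕ) : List ℕ → List ℕ
  | [] => []
  | a :: w => f a ++ applySub f w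

/-- σⁿ applied to a word. -/
def sigIter (d n : ℕ) (w : List ℕ) : List ℕ := (applySub (sig d))^[n] w

/-- The language L(Ω): the set of finite factors of the fixed point ω, i.e. of the
words σⁿ(1). -/
def Lang (d : ℕ) (u : List ℕ) : Prop := ∃ n : ℕ, u <:+: sigIter d n [1]

/-- `w` is a (finite) prefix of the infinite word `V`. -/
def PrefixOfInf (w : List ℕ) (V : ℕ → ℕ) : Prop :=
  ∀ (i : ℕ) (h : i < w.length), w.get ⟨i, h⟩ = V i

/-- `ω` is the fixed point of σ: the unique infinite word admitting every σⁿ(1) as a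
prefix. -/
def IsSigmaFixedPoint (d : ℕ) (ω : ℕ → ℕ) : Prop :=
  ∀ n : ℕ, PrefixOfInf (sigIter d n [1]) ω

/-- `u` is left-special: there are distinct letters a, b ∈ A with au, bu ∈ L(Ω). -/
def LeftSpecial (d : ℕ) (u : List ℕ) : Prop :=
  ∃ a b : ℕ, a ≠ b ∧ 1 ≤ a ∧ a ≤ d ∧ 1 ≤ b ∧ b ≤ d ∧
    Lang d (a :: u) ∧ Lang d (b :: u)

/-- `u` is right-special: there are distinct letters a, b ∈ A with ua, ub ∈ L(Ω). -/
def RightSpecial (d : ℕ) (u : List ℕ) : Prop :=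
  ∃ a b : ℕ, a ≠ b ∧ 1 ≤ a ∧ a ≤ d ∧ 1 ≤ b ∧ b ≤ d ∧
    Lang d (u ++ [a]) ∧ Lang d (u ++ [b])

/-- `u` is bispecial: both left- and right-special. -/
def Bispecial (d : ℕ) (u : List ℕ) : Prop := LeftSpecial d u ∧ RightSpecial d u

/-- The shift S on infinite words. -/
def shiftMap (V : ℕ → ℕ) : ℕ → ℕ := fun i => V (i + 1)

/-- Ω⁺ : the closure (for the product topology, letters discrete) of the shift
orbit of ω. -/
def OmegaPlus (ω : ℕ → ℕ) : Set (ℕ → ℕ) :=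
  closure {V : ℕ → ℕ | ∃ n : ℕ, V = shiftMap^[n] ω}

/-- The cylinder C_u = {V ∈ Ω⁺ : u is a prefix of V}. -/
def Cyl (ω : ℕ → ℕ) (u : List ℕ) : Set (ℕ → ℕ) :=
  {V | V ∈ OmegaPlus ω ∧ PrefixOfInf u V}

/-- Prepending a letter to an infinite word. -/
def consInf (a : ℕ) (V : ℕ → ℕ) : ℕ → ℕ :=
  fun i => match i with
  | 0 => a
  | j + 1 => V j

/-- Extension of σ to infinite words: σ(V) = σ(V₀)σ(V₁)σ(V₂)⋯ (each σ(a) is a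
nonempty word, so the n-th letter of σ(V) is the n-th letter of σ(V₀…Vₙ)). -/
def sigInf (d : ℕ) (V : ℕ → ℕ) : ℕ → ℕ :=
  fun n => (applySub (sig d) ((List.range (n + 1)).map V)).getD n 0

/-- Concatenation of a finite list of words. -/
def concatAll : List (List ℕ) → List ℕ
  | [] => []
  | w :: ws => w ++ concatAll ws

theorem applySub_append (f : ℕ → List ℕ) (v w : List ℕ) :
    applySub f (v ++ w) = applySub f v ++ applySub f w := by
  induction v with
  | nil => rfl
  | cons a v ih => simp [applySub, ih]

theorem sig_one (d : ℕ) : sig d 1 = [1, 2] := by simp [sig]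

theorem sig_of_ne {d a : ℕ} (h1 : a ≠ 1) (h2 : a ≠ d) : sig d a = [a + 1] := by
  simp [sig, h1, h2]

theorem length_sig_pos (d a : ℕ) : 1 ≤ (sig d a).length := by
  unfold sig
  split_ifs <;> simp

theorem length_le_length_applySub_sig (d : ℕ) (w : List ℕ) :
    w.length ≤ (applySub (sig d) w).length := by
  induction w with
  | nil => simp
  | cons a w ih =>
    have := length_sig_pos d a
    simp only [applySub, List.length_append, List.length_cons]
    omega

theorem mem_Icc_of_mem_sig {d a b : ℕ} (hd : 3 ≤ d) (ha : a ∈ Set.Icc 1 d) (hb : b ∈ sig d a) :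
    b ∈ Set.Icc 1 d := by
  obtain ⟨h1, h2⟩ := ha
  unfold sig at hb
  split_ifs at hb <;> simp at hb <;> simp only [Set.mem_Icc] <;> omega

theorem mem_Icc_of_mem_applySub_sig {d : ℕ} (hd : 3 ≤ d) {w : List ℕ}
    (hw : ∀ a ∈ w, a ∈ Set.Icc 1 d) : ∀ b ∈ applySub (sig d) w, b ∈ Set.Icc 1 d := by
  induction w with
  | nil => simp [applySub]
  | cons a w ih =>
    intro b hb
    rw [applySub, List.mem_append] at hb
    rcases hb with hb | hb
    · exact mem_Icc_of_mem_sig hd (hw a (by simp)) hb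
    · exact ih (fun c hc => hw c (by simp [hc])) b hb

theorem sigIter_succ (d n : ℕ) (w : List ℕ) :
    sigIter d (n + 1) w = applySub (sig d) (sigIter d n w) :=
  Function.iterate_succ_apply' _ _ _

theorem mem_Icc_of_mem_sigIter {d : ℕ} (hd : 3 ≤ d) (n : ℕ) :
    ∀ a ∈ sigIter d n [1], a ∈ Set.Icc 1 d := by
  induction n with
  | zero =>
    intro a ha
    simp only [sigIter, Function.iterate_zero, id, List.mem_singleton] at ha
    simp only [Set.mem_Icc]
    omega
  | succ n ih =>
    rw [sigIter_succ]
    exact mem_Icc_of_mem_applySub_sig hd ih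

theorem Lang.mem_Icc {d : ℕ} (hd : 3 ≤ d) {u : List ℕ} (hu : Lang d u) :
    ∀ a ∈ u, a ∈ Set.Icc 1 d := by
  obtain ⟨n, hn⟩ := hu
  exact fun a ha => mem_Icc_of_mem_sigIter hd n a (hn.subset ha)

theorem sigIter_eq_one_cons (d n : ℕ) : ∃ w, sigIter d n [1] = 1 :: w ∧ n ≤ w.length := by
  induction n with
  | zero => exact ⟨[], rfl, le_rfl⟩
  | succ n ih =>
    obtain ⟨w, hw, hn⟩ := ih
    refine ⟨2 :: applySub (sig d) w, ?_, ?_⟩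
    · rw [sigIter_succ, hw, applySub, sig_one]
      rfl
    · have := length_le_length_applySub_sig d w
      simp only [List.length_cons]
      omega

theorem lt_length_sigIter (d n : ℕ) : n < (sigIter d n [1]).length := by
  obtain ⟨w, hw, hn⟩ := sigIter_eq_one_cons d n
  rw [hw, List.length_cons]
  omega

theorem PrefixOfInf.eq_map_range {w : List ℕ} {V : ℕ → ℕ} (h : PrefixOfInf w V) :
    w = (List.range w.length).map V := by
  apply List.ext_getElem
  · simp
  · intro i h1 h2
    simpa using h i h1

theorem prefixOfInf_cons {a : ℕ} {w : List ℕ} {V : ℕ → ℕ} :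
    PrefixOfInf (a :: w) V ↔ a = V 0 ∧ PrefixOfInf w (shiftMap V) := by
  constructor
  · intro h
    refine ⟨h 0 (by simp), fun i hi => ?_⟩
    exact h (i + 1) (by simpa using hi)
  · rintro ⟨h0, h⟩ i hi
    cases i with
    | zero => exact h0
    | succ i => exact h i (by simpa using hi)

theorem applySub_map_range_prefix (f : ℕ → List ℕ) (V : ℕ → ℕ) {m n : ℕ} (h : m ≤ n) :
    applySub f ((List.range m).map V) <+: applySub f ((List.range n).map V) := by
  obtain ⟨k, rfl⟩ := Nat.exists_eq_add_of_le h
  rw [List.range_add, List.map_append, applySub_append]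
  exact List.prefix_append _ _

theorem List.IsPrefix.getD_eq_getD {v w : List ℕ} (h : v <+: w) {i : ℕ} (hi : i < v.length) :
    w.getD i 0 = v.getD i 0 := by
  obtain ⟨t, rfl⟩ := h
  exact List.getD_append _ _ _ _ hi

theorem lt_length_applySub_sig_map_range (d : ℕ) (V : ℕ → ℕ) {i m : ℕ} (h : i < m) :
    i < (applySub (sig d) ((List.range m).map V)).length :=
  lt_of_lt_of_le (by simpa using h) (length_le_length_applySub_sig d _)

/-- The `i`-th letter of `σ(V)` can be read in the image of any long enough prefix of `V`. -/
theorem sigInf_eq_getD (d : ℕ) (V : ℕ → ℕ) {i m : ℕ}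
    (hi : i < (applySub (sig d) ((List.range m).map V)).length) :
    sigInf d V i = (applySub (sig d) ((List.range m).map V)).getD i 0 := by
  have h := applySub_map_range_prefix (sig d) V (le_max_left m (i + 1))
  have h' := applySub_map_range_prefix (sig d) V (le_max_right m (i + 1))
  rw [sigInf, ← h.getD_eq_getD hi,
    h'.getD_eq_getD (lt_length_applySub_sig_map_range d V (Nat.lt_succ_self i))]

theorem PrefixOfInf.applySub_sig {w : List ℕ} {V : ℕ → ℕ} (h : PrefixOfInf w V) (d : ℕ) :
    PrefixOfInf (applySub (sig d) w) (sigInf d V) := by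
  intro i hi
  have hw := h.eq_map_range
  rw [sigInf_eq_getD d V (m := w.length) (by rwa [← hw]), ← hw]
  simp [hi]

theorem sigInf_add_length (d : ℕ) (V : ℕ → ℕ) (i : ℕ) :
    sigInf d V ((sig d (V 0)).length + i) = sigInf d (shiftMap V) i := by
  have hV : (List.range (i + 2)).map V = V 0 :: (List.range (i + 1)).map (shiftMap V) := by
    rw [List.range_succ_eq_map]
    simp [shiftMap, Function.comp_def]
  have hi := lt_length_applySub_sig_map_range d (shiftMap V) (Nat.lt_add_one i)
  rw [sigInf_eq_getD d V (m := i + 2), hV, applySub, List.getD_append_right _ _ _ _ (by omega),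
    sigInf, Nat.add_sub_cancel_left]
  rw [hV, applySub, List.length_append]
  omega

theorem prefixOfInf_sig_sigInf (d : ℕ) (V : ℕ → ℕ) : PrefixOfInf (sig d (V 0)) (sigInf d V) := by
  have h : PrefixOfInf [V 0] V := by
    rw [prefixOfInf_cons]
    exact ⟨rfl, fun i hi => absurd hi (by simp)⟩
  simpa [applySub] using h.applySub_sig d

theorem sigInf_zero_eq_one {d : ℕ} {V : ℕ → ℕ} (h : V 0 = 1 ∨ V 0 = d) : sigInf d V 0 = 1 := by
  have hw : ∃ w, sig d (V 0) = 1 :: w := by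
    unfold sig
    split_ifs <;> simp_all
  obtain ⟨w, hw⟩ := hw
  have := prefixOfInf_sig_sigInf d V
  rw [hw, prefixOfInf_cons] at this
  exact this.1.symm

theorem sigInf_zero_eq_succ {d : ℕ} {V : ℕ → ℕ} (h1 : V 0 ≠ 1) (h2 : V 0 ≠ d) :
    sigInf d V 0 = V 0 + 1 := by
  have := prefixOfInf_sig_sigInf d V
  rw [sig_of_ne h1 h2, prefixOfInf_cons] at this
  exact this.1.symm

theorem sigInf_one_eq_two {d : ℕ} {V : ℕ → ℕ} (h : V 0 = 1) : sigInf d V 1 = 2 := by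
  have := prefixOfInf_sig_sigInf d V
  rw [h, sig_one] at this
  exact (this 1 (by simp)).symm

theorem sigInf_zero_ne_two (d : ℕ) (V : ℕ → ℕ) : sigInf d V 0 ≠ 2 := by
  by_cases h1 : V 0 = 1 ∨ V 0 = d
  · rw [sigInf_zero_eq_one h1]
    omega
  · push Not at h1
    rw [sigInf_zero_eq_succ h1.1 h1.2]
    omega

theorem shiftMap_sigInf {d : ℕ} {V : ℕ → ℕ} (h : V 0 ≠ 1) :
    shiftMap (sigInf d V) = sigInf d (shiftMap V) := by
  have hl : (sig d (V 0)).length = 1 := by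
    unfold sig
    rw [if_neg h]
    split_ifs <;> simp
  funext i
  rw [← sigInf_add_length, hl, shiftMap, add_comm]

theorem shiftMap_shiftMap_sigInf {d : ℕ} {V : ℕ → ℕ} (h : V 0 = 1) :
    shiftMap (shiftMap (sigInf d V)) = sigInf d (shiftMap V) := by
  funext i
  rw [← sigInf_add_length, h, sig_one, shiftMap, shiftMap]
  congr 1
  simp only [List.length_cons, List.length_nil]
  omega

theorem continuous_sigInf (d : ℕ) : Continuous (sigInf d) := by
  refine continuous_pi fun n => ?_
  let g : (Fin (n + 1) → ℕ) → ℕ := fun x => (applySub (sig d) (List.ofFn x)).getD n 0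
  have h : (fun V : ℕ → ℕ => sigInf d V n) = g ∘ fun V i => V i := by
    funext V
    have : (List.range (n + 1)).map V = List.ofFn fun i : Fin (n + 1) => V i := by
      apply List.ext_getElem
      · simp
      · intro i h1 h2
        rw [List.getElem_map, List.getElem_range, List.getElem_ofFn]
    simp only [sigInf, g, Function.comp, this]
  rw [h]
  exact continuous_of_discreteTopology.comp (by fun_prop)

theorem IsSigmaFixedPoint.sigInf_eq {d : ℕ} {ω : ℕ → ℕ} (hω : IsSigmaFixedPoint d ω) :
    sigInf d ω = ω := by
  funext i
  have h := (hω i).applySub_sig d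
  have hi := (lt_length_sigIter d i).trans_le (length_le_length_applySub_sig d _)
  rw [← h i hi]
  rw [← sigIter_succ] at hi
  rw [← hω (i + 1) i hi]
  simp [sigIter_succ]

theorem IsSigmaFixedPoint.mem_Icc {d : ℕ} (hd : 3 ≤ d) {ω : ℕ → ℕ} (hω : IsSigmaFixedPoint d ω)
    (i : ℕ) : ω i ∈ Set.Icc 1 d := by
  rw [← hω i i (lt_length_sigIter d i)]
  exact mem_Icc_of_mem_sigIter hd i _ (List.get_mem _ _)

theorem shiftMap_iterate_apply (n : ℕ) (V : ℕ → ℕ) (i : ℕ) : shiftMap^[n] V i = V (i + n) := by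
  induction n generalizing V with
  | zero => rfl
  | succ n ih =>
    rw [Function.iterate_succ_apply, ih, shiftMap]
    rfl

theorem OmegaPlus_subset_pi_Icc {d : ℕ} (hd : 3 ≤ d) {ω : ℕ → ℕ} (hω : IsSigmaFixedPoint d ω) :
    OmegaPlus ω ⊆ Set.univ.pi fun _ => Set.Icc 1 d := by
  refine closure_minimal ?_ (isClosed_set_pi fun _ _ => isClosed_Icc)
  rintro _ ⟨n, rfl⟩ i -
  rw [shiftMap_iterate_apply]
  exact hω.mem_Icc hd _

theorem isCompact_OmegaPlus {d : ℕ} (hd : 3 ≤ d) {ω : ℕ → ℕ} (hω : IsSigmaFixedPoint d ω) :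
    IsCompact (OmegaPlus ω) :=
  (isCompact_univ_pi fun _ => isCompact_Icc).of_isClosed_subset isClosed_closure
    (OmegaPlus_subset_pi_Icc hd hω)

theorem IsSigmaFixedPoint.sigInf_shiftMap_iterate {d : ℕ} {ω : ℕ → ℕ}
    (hω : IsSigmaFixedPoint d ω) (m : ℕ) : ∃ n, sigInf d (shiftMap^[m] ω) = shiftMap^[n] ω := by
  induction m with
  | zero => exact ⟨0, hω.sigInf_eq⟩
  | succ m ih =>
    obtain ⟨n, hn⟩ := ih
    rw [Function.iterate_succ_apply']
    by_cases h : (shiftMap^[m] ω) 0 = 1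
    · refine ⟨n + 2, ?_⟩
      rw [← shiftMap_shiftMap_sigInf h, hn, Function.iterate_succ_apply',
        Function.iterate_succ_apply']
    · refine ⟨n + 1, ?_⟩
      rw [← shiftMap_sigInf h, hn, Function.iterate_succ_apply']

/-- Every shift of `ω` is cut either at the boundary of an image of a letter or between the two
letters of `σ(1)`. -/
theorem IsSigmaFixedPoint.shiftMap_iterate_eq {d : ℕ} {ω : ℕ → ℕ}
    (hω : IsSigmaFixedPoint d ω) (n : ℕ) :
    ∃ m, shiftMap^[n] ω = sigInf d (shiftMap^[m] ω) ∨
      (shiftMap^[m] ω) 0 = 1 ∧ shiftMap^[n] ω = shiftMap (sigInf d (shiftMap^[m] ω)) := by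
  induction n with
  | zero => exact ⟨0, Or.inl hω.sigInf_eq.symm⟩
  | succ n ih =>
    obtain ⟨m, hm | ⟨h1, hm⟩⟩ := ih
    · rw [Function.iterate_succ_apply', hm]
      by_cases h : (shiftMap^[m] ω) 0 = 1
      · exact ⟨m, Or.inr ⟨h, rfl⟩⟩
      · exact ⟨m + 1, Or.inl (by rw [shiftMap_sigInf h, Function.iterate_succ_apply'])⟩
    · refine ⟨m + 1, Or.inl ?_⟩
      rw [Function.iterate_succ_apply', hm, shiftMap_shiftMap_sigInf h1,
        Function.iterate_succ_apply']

theorem sigInf_mem_OmegaPlus {d : ℕ} {ω : ℕ → ℕ} (hω : IsSigmaFixedPoint d ω) {V : ℕ → ℕ}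
    (hV : V ∈ OmegaPlus ω) : sigInf d V ∈ OmegaPlus ω := by
  refine map_mem_closure (continuous_sigInf d) hV ?_
  rintro _ ⟨m, rfl⟩
  exact hω.sigInf_shiftMap_iterate m

theorem exists_sigInf_eq_of_mem_OmegaPlus {d : ℕ} (hd : 3 ≤ d) {ω : ℕ → ℕ}
    (hω : IsSigmaFixedPoint d ω) {W : ℕ → ℕ} (hW : W ∈ OmegaPlus ω) (h2 : W 0 ≠ 2) :
    ∃ V ∈ OmegaPlus ω, sigInf d V = W := by
  have hopen : IsOpen {V : ℕ → ℕ | V 0 ≠ 2} :=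
    isOpen_ne_fun (continuous_apply 0) continuous_const
  have hclosed : IsClosed (sigInf d '' OmegaPlus ω) :=
    ((isCompact_OmegaPlus hd hω).image (continuous_sigInf d)).isClosed
  refine closure_minimal ?_ hclosed (hopen.inter_closure ⟨h2, hW⟩)
  rintro _ ⟨hn, n, rfl⟩
  obtain ⟨m, hm | ⟨h1, hm⟩⟩ := hω.shiftMap_iterate_eq n
  · exact ⟨_, subset_closure ⟨m, rfl⟩, hm.symm⟩
  · refine absurd ?_ hn
    rw [hm]
    exact sigInf_one_eq_two h1

theorem prefixOfInf_append {v w : List ℕ} {V : ℕ → ℕ} :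
    PrefixOfInf (v ++ w) V ↔ PrefixOfInf v V ∧ PrefixOfInf w fun i => V (v.length + i) := by
  constructor
  · intro h
    refine ⟨fun i hi => ?_, fun i hi => ?_⟩
    · rw [← h i (by rw [List.length_append]; omega)]
      simp [hi]
    · have := h (v.length + i) (by rw [List.length_append]; omega)
      simpa using this
  · rintro ⟨hv, hw⟩ i hi
    by_cases h : i < v.length
    · rw [← hv i h]
      simp [h]
    · have hi' : i - v.length < w.length := by
        rw [List.length_append] at hi
        omega
      have := hw _ hi'
      simp only [Nat.add_sub_of_le (not_lt.mp h)] at this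
      rw [← this]
      simp [List.getElem_append_right (not_lt.mp h)]

theorem exists_sig_eq_cons (d a : ℕ) : ∃ b w, sig d a = b :: w ∧ b ≠ 2 := by
  unfold sig
  split_ifs
  · exact ⟨1, [2], rfl, by omega⟩
  · exact ⟨1, [], rfl, by omega⟩
  · exact ⟨a + 1, [], rfl, by omega⟩

theorem eq_head_of_prefixOfInf_sigInf {d : ℕ} (hd : 3 ≤ d) {a : ℕ} {w : List ℕ} {V : ℕ → ℕ}
    (hV : 1 ≤ V 0) (ha : 1 ≤ a) (hda : a = d → w ≠ [])
    (h : PrefixOfInf (applySub (sig d) (a :: w)) (sigInf d V)) : a = V 0 := by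
  have hV1 : V 0 ≠ 1 → sigInf d V 1 ≠ 2 := fun h1 => by
    change shiftMap (sigInf d V) 0 ≠ 2
    rw [shiftMap_sigInf h1]
    exact sigInf_zero_ne_two d _
  have hV0 : sigInf d V 0 = if V 0 = 1 ∨ V 0 = d then 1 else V 0 + 1 := by
    split_ifs with h0
    · exact sigInf_zero_eq_one h0
    · push Not at h0
      exact sigInf_zero_eq_succ h0.1 h0.2
  by_cases ha1 : a = 1
  · subst ha1
    rw [applySub, sig_one, List.cons_append, prefixOfInf_cons, List.cons_append,
      prefixOfInf_cons] at h
    by_contra hne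
    exact hV1 (Ne.symm hne) h.2.1.symm
  by_cases had : a = d
  · subst had
    obtain ⟨b, w, rfl⟩ := List.exists_cons_of_ne_nil (hda rfl)
    obtain ⟨c, t, hb, hc⟩ := exists_sig_eq_cons a b
    have hsig : sig a a = [1] := by simp [sig, ha1]
    rw [applySub, applySub, hsig, hb, List.cons_append, prefixOfInf_cons, List.nil_append,
      List.cons_append, prefixOfInf_cons] at h
    obtain ⟨h0, h1, -⟩ := h
    have hV1' : V 0 ≠ 1 := fun h' => hc (h1.trans (sigInf_one_eq_two h'))
    rw [hV0] at h0
    split_ifs at h0 <;> omega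
  · rw [applySub, sig_of_ne ha1 had, List.cons_append, prefixOfInf_cons, hV0] at h
    have h0 := h.1
    split_ifs at h0 <;> omega

theorem prefixOfInf_of_prefixOfInf_sigInf {d : ℕ} (hd : 3 ≤ d) {u : List ℕ} {V : ℕ → ℕ}
    (hV : ∀ i, 1 ≤ V i) (hu : ∀ a ∈ u, 1 ≤ a) (hne : u ≠ []) (hlast : u.getLast hne ≠ d)
    (h : PrefixOfInf (applySub (sig d) u) (sigInf d V)) : PrefixOfInf u V := by
  induction u generalizing V with
  | nil => exact absurd rfl hne
  | cons a w ih =>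
    have hda : a = d → w ≠ [] := by
      rintro rfl rfl
      exact hlast rfl
    have ha := eq_head_of_prefixOfInf_sigInf hd (hV 0) (hu a List.mem_cons_self) hda h
    rw [prefixOfInf_cons]
    refine ⟨ha, ?_⟩
    rcases eq_or_ne w [] with rfl | hw'
    · exact fun i hi => absurd hi (by simp)
    · refine ih (fun i => hV (i + 1)) (fun b hb => hu b (List.mem_cons_of_mem _ hb)) hw' ?_ ?_
      · rwa [List.getLast_cons hw'] at hlast
      · rw [applySub, prefixOfInf_append, ha] at h
        simpa only [sigInf_add_length] using h.2

/-- If u ∈ L(Ω) has last letter different from d, then σ(C_u) = C_{σ(u)}. -/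
theorem stmt_12 (d : ℕ) (hd : 3 ≤ d) (ω : ℕ → ℕ) (hω : IsSigmaFixedPoint d ω)
    (u : List ℕ) (hu : Lang d u) (hne : u ≠ []) (hlast : u.getLast hne ≠ d) :
    sigInf d '' Cyl ω u = Cyl ω (applySub (sig d) u) := by
  have hu' := hu.mem_Icc hd
  apply Set.Subset.antisymm
  · rintro _ ⟨V, ⟨hV, hprefix⟩, rfl⟩
    exact ⟨sigInf_mem_OmegaPlus hω hV, hprefix.applySub_sig d⟩
  · rintro W ⟨hW, hprefix⟩
    have hW2 : W 0 ≠ 2 := by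
      obtain ⟨a, w, rfl⟩ := List.exists_cons_of_ne_nil hne
      obtain ⟨b, t, hb, hb2⟩ := exists_sig_eq_cons d a
      rw [applySub, hb, List.cons_append, prefixOfInf_cons] at hprefix
      exact fun h => hb2 (hprefix.1.trans h)
    obtain ⟨V, hV, rfl⟩ := exists_sigInf_eq_of_mem_OmegaPlus hd hω hW hW2
    have hV1 : ∀ i, 1 ≤ V i := fun i => (OmegaPlus_subset_pi_Icc hd hω hV i trivial).1
    exact ⟨V, ⟨hV, prefixOfInf_of_prefixOfInf_sigInf hd hV1 (fun a ha => (hu' a ha).1) hne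
      hlast hprefix⟩, rfl⟩
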